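/- (Inversion of a 3-PI operator with invertible multiplier.) Let a < b be reals, n ∈ ℕ, let R₀ : [a,b] → ℝ^{n×n} be continuous with R₀(s) invertible for every s ∈ [a,b], and let R₁, R₂ : [a,b]² → ℝ^{n×n} be continuous. Suppose L₁, L₂ : [a,b]² → ℝ^{n×n} are continuous kernels such that the 3-PI operators 𝒫[I, (s,θ) ↦ R₀(s)⁻¹R₁(s,θ), (s,θ) ↦ R₀(s)⁻¹R₂(s,θ)] and 𝒫[I, L₁, L₂] are mutually inverse on C([a,b]; ℝⁿ). Then 𝒫[R₀, R₁, R₂] and 𝒫[R̂₀, R̂₁, R̂₂] are mutually inverse on C([a,b]; ℝⁿ), where R̂₀(s) = R₀(s)⁻¹ and R̂ᵢ(s,θ) = Lᵢ(s,θ) R₀(θ)⁻¹ for i ∈ {1,2}. -/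

import Mathlib

open MeasureTheory intervalIntegral

/-- The 3-PI operator `𝒫[N₀, N₁, N₂]` acting on functions `y : [a,b] → ℝⁿ`:
`(𝒫 y)(s) = N₀(s) y(s) + ∫_a^s N₁(s,θ) y(θ) dθ + ∫_s^b N₂(s,θ) y(θ) dθ`. -/
noncomputable def threePI {n : ℕ} (a b : ℝ)
    (N₀ : ℝ → Matrix (Fin n) (Fin n) ℝ)
    (N₁ N₂ : ℝ → ℝ → Matrix (Fin n) (Fin n) ℝ)
    (y : ℝ → Fin n → ℝ) : ℝ → Fin n → ℝ :=
  fun s => (N₀ s).mulVec (y s) + (∫ θ in a..s, (N₁ s θ).mulVec (y θ)) +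
    ∫ θ in s..b, (N₂ s θ).mulVec (y θ)

/-- Two operators on `C([a,b]; ℝⁿ)` are mutually inverse if both compositions restrict to
the identity on `[a,b]` for every continuous function. -/
def MutuallyInverseOn {n : ℕ} (a b : ℝ)
    (F G : (ℝ → Fin n → ℝ) → (ℝ → Fin n → ℝ)) : Prop :=
  ∀ y : ℝ → Fin n → ℝ, ContinuousOn y (Set.Icc a b) →
    (∀ s ∈ Set.Icc a b, F (G y) s = y s) ∧ (∀ s ∈ Set.Icc a b, G (F y) s = y s)

open Set Matrix

/-- An invertible matrix can be pulled out of an interval integral, whether or not the integrand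
is integrable. -/
theorem intervalIntegral_mulVec_of_isUnit {n : ℕ} {M : Matrix (Fin n) (Fin n) ℝ} (hM : IsUnit M)
    (f : ℝ → Fin n → ℝ) (c d : ℝ) :
    (∫ θ in c..d, M *ᵥ f θ) = M *ᵥ ∫ θ in c..d, f θ := by
  have := hM.invertible
  let e : (Fin n → ℝ) ≃L[ℝ] (Fin n → ℝ) := (M.toLinearEquiv' this).toContinuousLinearEquiv
  have he : ∀ v, e v = M *ᵥ v := fun v => rfl
  simp only [← he, intervalIntegral, e.integral_comp_comm, map_sub]

theorem ContinuousOn.matrix_inv {n : ℕ} {M : ℝ → Matrix (Fin n) (Fin n) ℝ} {t : Set ℝ}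
    (hM : ContinuousOn M t) (hu : ∀ s ∈ t, IsUnit (M s)) :
    ContinuousOn (fun s => (M s)⁻¹) t := by
  simp only [Matrix.inv_def, Ring.inverse_eq_inv']
  have hdet : ContinuousOn (fun s => (M s).det) t := continuous_id.matrix_det.comp_continuousOn hM
  have hadj : ContinuousOn (fun s => (M s).adjugate) t :=
    continuous_id.matrix_adjugate.comp_continuousOn hM
  exact (hdet.inv₀ fun s hs => ((isUnit_iff_isUnit_det _).1 (hu s hs)).ne_zero).smul hadj

/-- The values of a 3-PI operator on `[a,b]` depend only on the values of the argument there. -/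
theorem threePI_congr {n : ℕ} {a b : ℝ} (N₀ : ℝ → Matrix (Fin n) (Fin n) ℝ)
    (N₁ N₂ : ℝ → ℝ → Matrix (Fin n) (Fin n) ℝ) {y z : ℝ → Fin n → ℝ}
    (h : EqOn y z (Icc a b)) : EqOn (threePI a b N₀ N₁ N₂ y) (threePI a b N₀ N₁ N₂ z) (Icc a b) := by
  intro s hs
  have h₁ : (∫ θ in a..s, N₁ s θ *ᵥ y θ) = ∫ θ in a..s, N₁ s θ *ᵥ z θ := by
    refine intervalIntegral.integral_congr fun θ hθ => ?_
    rw [uIcc_of_le hs.1] at hθ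
    simp only [h ⟨hθ.1, hθ.2.trans hs.2⟩]
  have h₂ : (∫ θ in s..b, N₂ s θ *ᵥ y θ) = ∫ θ in s..b, N₂ s θ *ᵥ z θ := by
    refine intervalIntegral.integral_congr fun θ hθ => ?_
    rw [uIcc_of_le hs.2] at hθ
    simp only [h ⟨hs.1.trans hθ.1, hθ.2⟩]
  simp only [threePI, h hs, h₁, h₂]

/-- Left factorisation of the multiplier out of a 3-PI operator. -/
theorem threePI_inv_mul {n : ℕ} (a b : ℝ) {R₀ : ℝ → Matrix (Fin n) (Fin n) ℝ}
    (R₁ R₂ : ℝ → ℝ → Matrix (Fin n) (Fin n) ℝ) (y : ℝ → Fin n → ℝ) {s : ℝ} (hs : IsUnit (R₀ s)) :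
    threePI a b (fun _ => 1) (fun s θ => (R₀ s)⁻¹ * R₁ s θ) (fun s θ => (R₀ s)⁻¹ * R₂ s θ) y s =
      (R₀ s)⁻¹ *ᵥ threePI a b R₀ R₁ R₂ y s := by
  have hi : IsUnit (R₀ s)⁻¹ := isUnit_nonsing_inv_iff.2 hs
  simp only [threePI, ← mulVec_mulVec, intervalIntegral_mulVec_of_isUnit hi, mulVec_add]
  rw [mulVec_mulVec, nonsing_inv_mul _ ((isUnit_iff_isUnit_det _).1 hs)]

/-- Right factorisation of a pointwise multiplication out of a 3-PI operator. -/
theorem threePI_mul_right {n : ℕ} (a b : ℝ) (M : ℝ → Matrix (Fin n) (Fin n) ℝ)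
    (L₁ L₂ : ℝ → ℝ → Matrix (Fin n) (Fin n) ℝ) (y : ℝ → Fin n → ℝ) :
    threePI a b M (fun s θ => L₁ s θ * M θ) (fun s θ => L₂ s θ * M θ) y =
      threePI a b (fun _ => 1) L₁ L₂ (fun θ => M θ *ᵥ y θ) := by
  funext s
  simp only [threePI, mulVec_mulVec, one_mul]

/-- **Inversion of a 3-PI operator with invertible multiplier.** If
`𝒫[I, R₀⁻¹R₁, R₀⁻¹R₂]` and `𝒫[I, L₁, L₂]` are mutually inverse, then `𝒫[R₀, R₁, R₂]` and
`𝒫[R₀⁻¹, L₁ R₀⁻¹, L₂ R₀⁻¹]` are mutually inverse. -/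
theorem threePI_inversion {n : ℕ} (a b : ℝ) (hab : a < b)
    (R₀ : ℝ → Matrix (Fin n) (Fin n) ℝ)
    (hR₀_cont : ContinuousOn R₀ (Set.Icc a b))
    (hR₀_inv : ∀ s ∈ Set.Icc a b, IsUnit (R₀ s))
    (R₁ R₂ L₁ L₂ : ℝ → ℝ → Matrix (Fin n) (Fin n) ℝ)
    (hR₁_cont : ContinuousOn (fun z : ℝ × ℝ => R₁ z.1 z.2) (Set.Icc a b ×ˢ Set.Icc a b))
    (hR₂_cont : ContinuousOn (fun z : ℝ × ℝ => R₂ z.1 z.2) (Set.Icc a b ×ˢ Set.Icc a b))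
    (hL₁_cont : ContinuousOn (fun z : ℝ × ℝ => L₁ z.1 z.2) (Set.Icc a b ×ˢ Set.Icc a b))
    (hL₂_cont : ContinuousOn (fun z : ℝ × ℝ => L₂ z.1 z.2) (Set.Icc a b ×ˢ Set.Icc a b))
    (h_inv : MutuallyInverseOn a b
      (threePI a b (fun _ => (1 : Matrix (Fin n) (Fin n) ℝ))
        (fun s θ => (R₀ s)⁻¹ * R₁ s θ) (fun s θ => (R₀ s)⁻¹ * R₂ s θ))
      (threePI a b (fun _ => (1 : Matrix (Fin n) (Fin n) ℝ)) L₁ L₂)) :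
    MutuallyInverseOn a b
      (threePI a b R₀ R₁ R₂)
      (threePI a b (fun s => (R₀ s)⁻¹)
        (fun s θ => L₁ s θ * (R₀ θ)⁻¹) (fun s θ => L₂ s θ * (R₀ θ)⁻¹)) := by
  intro y hy
  have hMy : ContinuousOn (fun θ => (R₀ θ)⁻¹ *ᵥ y θ) (Icc a b) :=
    (continuous_fst.matrix_mulVec continuous_snd).comp_continuousOn
      ((hR₀_cont.matrix_inv hR₀_inv).prodMk hy)
  refine ⟨fun s hs => ?_, fun s hs => ?_⟩
  · have h := (h_inv _ hMy).1 s hs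
    rw [threePI_inv_mul a b R₁ R₂ _ (hR₀_inv s hs)] at h
    rw [threePI_mul_right]
    exact mulVec_injective_of_isUnit (isUnit_nonsing_inv_iff.2 (hR₀_inv s hs)) h
  · rw [threePI_mul_right, ← (h_inv y hy).2 s hs]
    exact threePI_congr _ _ _ (fun θ hθ => (threePI_inv_mul a b R₁ R₂ y (hR₀_inv θ hθ)).symm) hs
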